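/- Let P and Q be two non-negative integrable functions on ℝ (with Lebesgue measure). Then the pair of conditions '∫₀ˣ P*(u) du ≤ ∫₀ˣ λ_Q(u) du for all x > 0 and ∫₀ˣ Q*(u) du ≤ ∫₀ˣ λ_P(u) du for all x > 0' is equivalent to the pair of conditions '∫₀ˣ P*(u) du ≤ ∫₀ˣ λ_Q(u) du for all x > 0 and ‖P‖_{L¹} = ‖Q‖_{L¹}'. -/

import Mathlib

open MeasureTheory ENNReal

/-- The distribution function `λ_f(s) = μ({x : |f(x)| > s})`. -/
noncomputable def distFn {α : Type*} [MeasurableSpace α] (μ : Measure α) (f : α → ℝ)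
    (s : ℝ) : ℝ≥0∞ :=
  μ {x | s < |f x|}

/-- The nonincreasing rearrangement `f*(t) = inf{s > 0 : λ_f(s) ≤ t}` (with value `∞` if no
such `s` exists). -/
noncomputable def rearr {α : Type*} [MeasurableSpace α] (μ : Measure α) (f : α → ℝ)
    (t : ℝ) : ℝ≥0∞ :=
  sInf (ENNReal.ofReal '' {s : ℝ | 0 < s ∧ distFn μ f s ≤ ENNReal.ofReal t})

lemma distFn_antitone {α : Type*} [MeasurableSpace α] (μ : Measure α) (f : α → ℝ) :
    Antitone (distFn μ f) :=
  fun _ _ h => measure_mono fun _ hx => lt_of_le_of_lt h hx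

lemma rearr_antitone {α : Type*} [MeasurableSpace α] (μ : Measure α) (f : α → ℝ) :
    Antitone (rearr μ f) :=
  fun _ _ h => sInf_le_sInf <| Set.image_mono fun _ hs =>
    ⟨hs.1, hs.2.trans (ENNReal.ofReal_le_ofReal h)⟩

/-- Right-continuity of the distribution function, in the form of an upper bound. -/
lemma distFn_le_of_forall_gt {α : Type*} [MeasurableSpace α] (μ : Measure α) (f : α → ℝ)
    {s : ℝ} {c : ℝ≥0∞} (h : ∀ r, s < r → distFn μ f r ≤ c) : distFn μ f s ≤ c := by
  obtain ⟨r, hr_anti, hr_gt, hr_lim⟩ := exists_seq_strictAnti_tendsto s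
  have hU : {x | s < |f x|} = ⋃ n, {x | r n < |f x|} := by
    ext x
    simp only [Set.mem_ofPred_eq, Set.mem_iUnion]
    refine ⟨fun hx => (hr_lim.eventually_lt_const hx).exists, ?_⟩
    rintro ⟨n, hn⟩
    exact (hr_gt n).trans hn
  have hmono : Monotone fun n => {x | r n < |f x|} :=
    fun m n hmn x hx => lt_of_le_of_lt (hr_anti.antitone hmn) hx
  rw [distFn, hU, hmono.measure_iUnion]
  exact iSup_le fun n => h (r n) (hr_gt n)

/-- The rearrangement and the distribution function form a Galois-type pair. -/
lemma ofReal_lt_rearr_iff {α : Type*} [MeasurableSpace α] (μ : Measure α) (f : α → ℝ)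
    {s t : ℝ} (hs : 0 < s) :
    ENNReal.ofReal s < rearr μ f t ↔ ENNReal.ofReal t < distFn μ f s := by
  rw [← not_le, ← not_le, not_iff_not]
  refine ⟨fun h => distFn_le_of_forall_gt μ f fun r hr => ?_,
    fun h => sInf_le ⟨s, ⟨hs, h⟩, rfl⟩⟩
  have hlt : rearr μ f t < ENNReal.ofReal r :=
    h.trans_lt ((ENNReal.ofReal_lt_ofReal_iff (hs.trans hr)).2 hr)
  obtain ⟨_, ⟨q, hq, rfl⟩, hqr⟩ := sInf_lt_iff.1 hlt
  exact (distFn_antitone μ f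
    ((ENNReal.ofReal_lt_ofReal_iff (hs.trans hr)).1 hqr).le).trans hq.2

lemma volume_Ioi_zero_inter_ofReal_lt (c : ℝ≥0∞) :
    volume (Set.Ioi (0 : ℝ) ∩ {s | ENNReal.ofReal s < c}) = c := by
  induction c with
  | top => simp
  | coe c =>
    have : Set.Ioi (0 : ℝ) ∩ {s | ENNReal.ofReal s < c} = Set.Ioo 0 (c : ℝ) := by
      ext s
      simp only [Set.mem_inter_iff, Set.mem_Ioi, Set.mem_ofPred_eq, Set.mem_Ioo]
      refine and_congr_right fun hs => ?_
      rw [ENNReal.ofReal_lt_iff_lt_toReal hs.le ENNReal.coe_ne_top, ENNReal.coe_toReal]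
    rw [this, Real.volume_Ioo, sub_zero, ENNReal.ofReal_coe_nnreal]

lemma volume_Ioo_zero_inter_ofReal_lt (c : ℝ≥0∞) (t : ℝ) :
    volume (Set.Ioo 0 t ∩ {s | ENNReal.ofReal s < c}) = min c (ENNReal.ofReal t) := by
  rw [← volume_Ioi_zero_inter_ofReal_lt (min c (ENNReal.ofReal t))]
  congr 1
  ext s
  simp only [Set.mem_inter_iff, Set.mem_Ioo, Set.mem_Ioi, Set.mem_ofPred_eq, lt_min_iff]
  constructor
  · rintro ⟨⟨h0, h1⟩, h2⟩
    exact ⟨h0, h2, (ENNReal.ofReal_lt_ofReal_iff (h0.trans h1)).2 h1⟩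
  · rintro ⟨h0, h1, h2⟩
    exact ⟨⟨h0, (ENNReal.ofReal_lt_ofReal_iff_of_nonneg h0.le).1 h2⟩, h1⟩

lemma setLIntegral_measure_ofReal_lt {α : Type*} [MeasurableSpace α] (μ : Measure α) [SFinite μ]
    {g : α → ℝ≥0∞} (hg : Measurable g) (S : Set ℝ) :
    ∫⁻ s in S, μ {u | ENNReal.ofReal s < g u} =
      ∫⁻ u, volume (S ∩ {s | ENNReal.ofReal s < g u}) ∂μ := by
  have hD : MeasurableSet {p : ℝ × α | ENNReal.ofReal p.1 < g p.2} :=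
    measurableSet_lt (by fun_prop) (by fun_prop)
  have h1 := Measure.prod_apply (μ := volume.restrict S) (ν := μ) hD
  rw [Measure.prod_apply_symm hD] at h1
  refine h1.symm.trans (lintegral_congr fun u => ?_)
  rw [Measure.restrict_apply (measurable_prodMk_right hD), Set.inter_comm]
  rfl

lemma setLIntegral_distFn_eq {α : Type*} [MeasurableSpace α] (μ : Measure α) (f : α → ℝ)
    {S : Set ℝ} (hS : MeasurableSet S) (h0 : S ⊆ Set.Ioi 0) :
    ∫⁻ s in S, distFn μ f s =
      ∫⁻ u in Set.Ioi 0, volume (S ∩ {s | ENNReal.ofReal s < rearr μ f u}) := by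
  have hm := (rearr_antitone μ f).measurable
  rw [← setLIntegral_measure_ofReal_lt _ hm]
  refine setLIntegral_congr_fun hS fun s hs => ?_
  have : {u | ENNReal.ofReal s < rearr μ f u} = {u | ENNReal.ofReal u < distFn μ f s} :=
    Set.ext fun u => ofReal_lt_rearr_iff μ f (h0 hs)
  rw [Measure.restrict_apply (measurableSet_lt measurable_const hm), this, Set.inter_comm,
    volume_Ioi_zero_inter_ofReal_lt]

lemma setLIntegral_rearr_eq {α : Type*} [MeasurableSpace α] (μ : Measure α) (f : α → ℝ)
    {S : Set ℝ} (hS : MeasurableSet S) :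
    ∫⁻ s in S, rearr μ f s =
      ∫⁻ u in Set.Ioi 0, volume (S ∩ {s | ENNReal.ofReal s < distFn μ f u}) := by
  have hm := (distFn_antitone μ f).measurable
  rw [← setLIntegral_measure_ofReal_lt _ hm]
  refine setLIntegral_congr_fun hS fun s _ => ?_
  rw [Measure.restrict_apply (measurableSet_lt measurable_const hm), Set.inter_comm]
  conv_lhs => rw [← volume_Ioi_zero_inter_ofReal_lt (rearr μ f s)]
  congr 1
  ext u
  exact and_congr_right fun hu => ofReal_lt_rearr_iff μ f hu

lemma lintegral_Ioi_rearr {α : Type*} [MeasurableSpace α] (μ : Measure α) (f : α → ℝ) :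
    ∫⁻ s in Set.Ioi 0, rearr μ f s = ∫⁻ s in Set.Ioi 0, distFn μ f s := by
  rw [setLIntegral_rearr_eq μ f measurableSet_Ioi]
  simp only [volume_Ioi_zero_inter_ofReal_lt]

lemma lintegral_Ioi_distFn {f : ℝ → ℝ} (hf0 : ∀ x, 0 ≤ f x) (hf : Integrable f volume) :
    ∫⁻ s in Set.Ioi 0, distFn volume f s = ENNReal.ofReal (∫ x, f x) := by
  rw [ofReal_integral_eq_lintegral_ofReal hf (.of_forall hf0),
    lintegral_eq_lintegral_meas_lt volume (.of_forall hf0) hf.aemeasurable]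
  simp only [distFn, abs_of_nonneg (hf0 _)]

lemma lintegral_Ioi_le_of_forall_Ioo {g h : ℝ → ℝ≥0∞}
    (H : ∀ x : ℝ, 0 < x → ∫⁻ u in Set.Ioo 0 x, g u ≤ ∫⁻ u in Set.Ioo 0 x, h u) :
    ∫⁻ u in Set.Ioi 0, g u ≤ ∫⁻ u in Set.Ioi 0, h u := by
  have hU : Set.Ioi (0 : ℝ) = ⋃ n : ℕ, Set.Ioo 0 ((n : ℝ) + 1) := by
    ext u
    simp only [Set.mem_Ioi, Set.mem_iUnion, Set.mem_Ioo]
    refine ⟨fun hu => ?_, fun ⟨_, hn⟩ => hn.1⟩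
    obtain ⟨n, hn⟩ := exists_nat_gt u
    exact ⟨n, hu, by linarith⟩
  have hmono : Monotone fun n : ℕ => Set.Ioo (0 : ℝ) ((n : ℝ) + 1) :=
    fun m n hmn => Set.Ioo_subset_Ioo_right (by gcongr)
  conv_lhs => rw [hU]
  rw [setLIntegral_iUnion_of_directed _ hmono.directed_le]
  exact iSup_le fun n => (H _ (by positivity)).trans
    (lintegral_mono_set Set.Ioo_subset_Ioi_self)

/-- Truncated excesses inherit the comparison of the primitives. -/
lemma lintegral_rearr_tsub_le {f : ℝ → ℝ} {g : ℝ → ℝ≥0∞} {t : ℝ} (ht : 0 < t)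
    (hfin : distFn volume f t ≠ ∞)
    (H : ∀ x : ℝ, 0 < x → ∫⁻ u in Set.Ioo 0 x, rearr volume f u ≤ ∫⁻ u in Set.Ioo 0 x, g u) :
    ∫⁻ u in Set.Ioi 0, (rearr volume f u - ENNReal.ofReal t) ≤
      ∫⁻ u in Set.Ioi 0, (g u - ENNReal.ofReal t) := by
  set a := (distFn volume f t).toReal
  have hmem : ∀ u, 0 < u → (ENNReal.ofReal t < rearr volume f u ↔ u < a) := fun u hu => by
    rw [ofReal_lt_rearr_iff _ _ ht, ENNReal.ofReal_lt_iff_lt_toReal hu.le hfin]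
  have hcut : ∫⁻ u in Set.Ioi 0, (rearr volume f u - ENNReal.ofReal t) =
      ∫⁻ u in Set.Ioo 0 a, (rearr volume f u - ENNReal.ofReal t) := by
    rw [← lintegral_inter_add_sdiff _ (Set.Ioi 0) (measurableSet_Ioo (a := 0) (b := a)),
      Set.inter_eq_self_of_subset_right Set.Ioo_subset_Ioi_self,
      setLIntegral_eq_zero (measurableSet_Ioi.diff measurableSet_Ioo), add_zero]
    rintro u ⟨hu, hua⟩
    exact tsub_eq_zero_of_le (not_lt.1 fun hlt => hua ⟨hu, (hmem u hu).1 hlt⟩)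
  rw [hcut]
  rcases le_or_gt a 0 with h0 | hpos
  · simp [Set.Ioo_eq_empty_of_le h0]
  have hc : ∫⁻ _ in Set.Ioo 0 a, ENNReal.ofReal t ≠ ∞ := by
    rw [setLIntegral_const]
    exact ENNReal.mul_ne_top ENNReal.ofReal_ne_top (by simp)
  refine le_trans ?_ (lintegral_mono_set (Set.Ioo_subset_Ioi_self (a := a) (b := 0)))
  refine (ENNReal.add_le_add_iff_right hc).1 ?_
  rw [← lintegral_add_right _ measurable_const, ← lintegral_add_right _ measurable_const]
  calc ∫⁻ u in Set.Ioo 0 a, (rearr volume f u - ENNReal.ofReal t + ENNReal.ofReal t)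
      = ∫⁻ u in Set.Ioo 0 a, rearr volume f u :=
        setLIntegral_congr_fun measurableSet_Ioo fun u hu =>
          tsub_add_cancel_of_le ((hmem u hu.1).2 hu.2).le
    _ ≤ ∫⁻ u in Set.Ioo 0 a, g u := H a hpos
    _ ≤ _ := lintegral_mono fun u => le_tsub_add

lemma distFn_ne_top {f : ℝ → ℝ} (hf : Integrable f volume) {t : ℝ} (ht : 0 < t) :
    distFn volume f t ≠ ∞ := by
  simpa [distFn] using (hf.abs.measure_gt_lt_top ht).ne

lemma lintegral_min_add_tsub {α : Type*} [MeasurableSpace α] (μ : Measure α) {g : α → ℝ≥0∞}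
    (hg : Measurable g) (c : ℝ≥0∞) :
    ∫⁻ u, min (g u) c ∂μ + ∫⁻ u, (g u - c) ∂μ = ∫⁻ u, g u ∂μ := by
  rw [← lintegral_add_left (hg.min measurable_const)]
  refine lintegral_congr fun u => ?_
  rw [add_comm, tsub_add_min]

/-- For non-negative integrable `P, Q` on `ℝ`, the pair of conditions
`∫₀ˣ P*(u) du ≤ ∫₀ˣ λ_Q(u) du` and `∫₀ˣ Q*(u) du ≤ ∫₀ˣ λ_P(u) du` (for all `x > 0`) is
equivalent to `∫₀ˣ P*(u) du ≤ ∫₀ˣ λ_Q(u) du` (for all `x > 0`) together with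
`‖P‖₁ = ‖Q‖₁`. -/
theorem lorentz_conditions_iff (P Q : ℝ → ℝ) (hP0 : ∀ x, 0 ≤ P x) (hQ0 : ∀ y, 0 ≤ Q y)
    (hPi : Integrable P volume) (hQi : Integrable Q volume) :
    ((∀ x : ℝ, 0 < x →
        ∫⁻ u in Set.Ioo 0 x, rearr volume P u ≤ ∫⁻ u in Set.Ioo 0 x, distFn volume Q u) ∧
      (∀ x : ℝ, 0 < x →
        ∫⁻ u in Set.Ioo 0 x, rearr volume Q u ≤ ∫⁻ u in Set.Ioo 0 x, distFn volume P u)) ↔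
    ((∀ x : ℝ, 0 < x →
        ∫⁻ u in Set.Ioo 0 x, rearr volume P u ≤ ∫⁻ u in Set.Ioo 0 x, distFn volume Q u) ∧
      ∫ x, P x = ∫ x, Q x) := by
  have iP := lintegral_Ioi_distFn hP0 hPi
  have iQ := lintegral_Ioi_distFn hQ0 hQi
  have rP := lintegral_Ioi_rearr volume P
  have rQ := lintegral_Ioi_rearr volume Q
  refine and_congr_right fun hA => ⟨fun hB => ?_, fun hN t ht => ?_⟩
  · have h1 := lintegral_Ioi_le_of_forall_Ioo hA
    have h2 := lintegral_Ioi_le_of_forall_Ioo hB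
    rw [rP, iP, iQ] at h1
    rw [rQ, iP, iQ] at h2
    exact le_antisymm ((ENNReal.ofReal_le_ofReal_iff (integral_nonneg hQ0)).1 h1)
      ((ENNReal.ofReal_le_ofReal_iff (integral_nonneg hP0)).1 h2)
  · rw [setLIntegral_rearr_eq volume Q measurableSet_Ioo,
      setLIntegral_distFn_eq volume P measurableSet_Ioo Set.Ioo_subset_Ioi_self]
    simp only [volume_Ioo_zero_inter_ofReal_lt]
    have hle := lintegral_rearr_tsub_le ht (distFn_ne_top hPi ht) hA
    have eP := lintegral_min_add_tsub (volume.restrict (Set.Ioi 0))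
      (rearr_antitone volume P).measurable (ENNReal.ofReal t)
    have eQ := lintegral_min_add_tsub (volume.restrict (Set.Ioi 0))
      (distFn_antitone volume Q).measurable (ENNReal.ofReal t)
    rw [rP, iP, hN, ← iQ, ← eQ] at eP
    have hfin : ∫⁻ u in Set.Ioi 0, (distFn volume Q u - ENNReal.ofReal t) ≠ ∞ :=
      ne_top_of_le_ne_top (iQ ▸ ENNReal.ofReal_ne_top) (lintegral_mono fun u => tsub_le_self)
    refine (ENNReal.add_le_add_iff_right hfin).1 ?_
    rw [← eP]
    gcongr
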